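/- arXiv:1307.0986 — 2 statements merged into one kernel-verified Lean document; each statement's English description precedes it below -/
import Mathlib

section
/- Let η, Γ, ξ, s ∈ ℝ, let n ∈ ℝ³ be a unit vector, let N ∈ ℝ³ satisfy N·n = 0, and let D ∈ 𝕊₀. Set Q₀ = s(nn − (1/3)I) and H₀ = −Γs(N⊗n + n⊗N) + Γ S_{Q₀}(D). Define α₁ = −(2Γξ²s²(3−2s)(1+2s))/3, α₂ = Γs² − (Γξs(2+s))/3, α₃ = −Γs² − (Γξs(2+s))/3, α₄ = η + (4Γξ²(1−s)²)/9, α₅ = (Γξ²s(4−s))/3 − (Γξs(2+s))/3, α₆ = (Γξ²s(4−s))/3 + (Γξs(2+s))/3. Then there exists λ ∈ ℝ such that ηD + S_{Q₀}(H₀) − Q₀·H₀ + H₀·Q₀ = α₁(nn:D)nn + α₂ n⊗N + α₃ N⊗n + α₄ D + α₅ nn·D + α₆ D·nn + λI. -/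
open Matrix

/-- Frobenius inner product `A:B = tr(A·B)`. -/
noncomputable def frob (A B : Matrix (Fin 3) (Fin 3) ℝ) : ℝ := (A * B).trace

/-- `S_Q(M) = ξ( M·(Q + (1/3)I) + (Q + (1/3)I)·M − 2(Q + (1/3)I)(Q:M) )`. -/
noncomputable def Sop (ξ : ℝ) (Q M : Matrix (Fin 3) (Fin 3) ℝ) :
    Matrix (Fin 3) (Fin 3) ℝ :=
  ξ • (M * (Q + (1 / 3 : ℝ) • (1 : Matrix (Fin 3) (Fin 3) ℝ))
      + (Q + (1 / 3 : ℝ) • (1 : Matrix (Fin 3) (Fin 3) ℝ)) * M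
      - (2 * frob Q M) • (Q + (1 / 3 : ℝ) • (1 : Matrix (Fin 3) (Fin 3) ℝ)))

/-- `S_Q` at a uniaxial `Q = s(P - I/3)`, written in terms of products with `P`. -/
theorem Sop_uniaxial (ξ s : ℝ) (P M : Matrix (Fin 3) (Fin 3) ℝ) :
    Sop ξ (s • (P - (1 / 3 : ℝ) • (1 : Matrix (Fin 3) (Fin 3) ℝ))) M =
      ξ • (s • (M * P + P * M) + (2 * (1 - s) / 3) • M
        - (2 * s * ((P * M).trace - M.trace / 3)) •
          (s • P + ((1 - s) / 3) • (1 : Matrix (Fin 3) (Fin 3) ℝ))) := by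
  simp only [Sop, frob, Matrix.smul_mul, Matrix.sub_mul, Matrix.mul_add, Matrix.add_mul,
    Matrix.mul_sub, Matrix.mul_smul, Matrix.one_mul, Matrix.mul_one, Matrix.trace_smul,
    Matrix.trace_sub, smul_eq_mul]
  module

theorem trace_vecMulVec_mul (u v : Fin 3 → ℝ) (D : Matrix (Fin 3) (Fin 3) ℝ) :
    (vecMulVec u v * D).trace = v ⬝ᵥ D *ᵥ u := by
  rw [Matrix.vecMulVec_mul, Matrix.trace_vecMulVec, dotProduct_comm, Matrix.dotProduct_mulVec]

/-- The limiting viscous stress of the Beris-Edwards system has the Leslie form: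
`ηD + S_{Q₀}(H₀) − Q₀·H₀ + H₀·Q₀
  = α₁(nn:D)nn + α₂ n⊗N + α₃ N⊗n + α₄ D + α₅ nn·D + α₆ D·nn + λI`
for some pressure-like `λ ∈ ℝ`. -/
theorem stmt_16 (η Γ ξ s : ℝ) (n : Fin 3 → ℝ) (hn : n ⬝ᵥ n = 1)
    (N : Fin 3 → ℝ) (hN : N ⬝ᵥ n = 0)
    (D : Matrix (Fin 3) (Fin 3) ℝ) (hDsymm : D.IsSymm) (hDtr : D.trace = 0)
    (Q₀ H₀ : Matrix (Fin 3) (Fin 3) ℝ)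
    (hQ₀ : Q₀ = s • (vecMulVec n n - (1 / 3 : ℝ) • (1 : Matrix (Fin 3) (Fin 3) ℝ)))
    (hH₀ : H₀ = (-(Γ * s)) • (vecMulVec N n + vecMulVec n N) + Γ • Sop ξ Q₀ D)
    (α₁ α₂ α₃ α₄ α₅ α₆ : ℝ)
    (hα₁ : α₁ = -(2 * Γ * ξ ^ 2 * s ^ 2 * (3 - 2 * s) * (1 + 2 * s)) / 3)
    (hα₂ : α₂ = Γ * s ^ 2 - Γ * ξ * s * (2 + s) / 3)
    (hα₃ : α₃ = -(Γ * s ^ 2) - Γ * ξ * s * (2 + s) / 3)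
    (hα₄ : α₄ = η + 4 * Γ * ξ ^ 2 * (1 - s) ^ 2 / 9)
    (hα₅ : α₅ = Γ * ξ ^ 2 * s * (4 - s) / 3 - Γ * ξ * s * (2 + s) / 3)
    (hα₆ : α₆ = Γ * ξ ^ 2 * s * (4 - s) / 3 + Γ * ξ * s * (2 + s) / 3) :
    ∃ lam : ℝ,
      η • D + Sop ξ Q₀ H₀ - Q₀ * H₀ + H₀ * Q₀ =
        (α₁ * (n ⬝ᵥ D *ᵥ n)) • vecMulVec n n + α₂ • vecMulVec n N + α₃ • vecMulVec N n
          + α₄ • D + α₅ • (vecMulVec n n * D) + α₆ • (D * vecMulVec n n)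
          + lam • (1 : Matrix (Fin 3) (Fin 3) ℝ) := by
  have hN' : n ⬝ᵥ N = 0 := by rw [dotProduct_comm, hN]
  have hPP : vecMulVec n n * vecMulVec n n = vecMulVec n n := by
    simp [Matrix.vecMulVec_mul_vecMulVec, hn]
  have hPU : vecMulVec n n * vecMulVec N n = 0 := by
    simp [Matrix.vecMulVec_mul_vecMulVec, hN']
  have hPV : vecMulVec n n * vecMulVec n N = vecMulVec n N := by
    simp [Matrix.vecMulVec_mul_vecMulVec, hn]
  have hUP : vecMulVec N n * vecMulVec n n = vecMulVec N n := by
    simp [Matrix.vecMulVec_mul_vecMulVec, hn]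
  have hVP : vecMulVec n N * vecMulVec n n = 0 := by
    simp [Matrix.vecMulVec_mul_vecMulVec, hN]
  have hPDP : vecMulVec n n * (D * vecMulVec n n) = (n ⬝ᵥ D *ᵥ n) • vecMulVec n n := by
    rw [Matrix.mul_vecMulVec, Matrix.vecMulVec_mul_vecMulVec, Matrix.vecMulVec_smul]
  have hPPD : vecMulVec n n * (vecMulVec n n * D) = vecMulVec n n * D := by
    rw [← Matrix.mul_assoc, hPP]
  have htP : (vecMulVec n n).trace = 1 := by rw [Matrix.trace_vecMulVec, hn]
  have htU : (vecMulVec N n).trace = 0 := by rw [Matrix.trace_vecMulVec, hN]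
  have htV : (vecMulVec n N).trace = 0 := by rw [Matrix.trace_vecMulVec, hN']
  have htX : (vecMulVec n n * D).trace = n ⬝ᵥ D *ᵥ n := trace_vecMulVec_mul n n D
  have htY : (D * vecMulVec n n).trace = n ⬝ᵥ D *ᵥ n := by rw [Matrix.trace_mul_comm, htX]
  subst hQ₀ hα₁ hα₂ hα₃ hα₄ hα₅ hα₆
  rw [Sop_uniaxial, htX, hDtr] at hH₀
  rw [Sop_uniaxial]
  generalize vecMulVec n n = P at *
  generalize vecMulVec N n = U at *
  generalize vecMulVec n N = V at *
  generalize n ⬝ᵥ D *ᵥ n = q at *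
  subst hH₀
  refine ⟨Γ * ξ ^ 2 * (-4 * s * q * ((1 - s) / 3) ^ 2 - 2 * s * q * ((1 - s) / 3) *
    (2 * s + 2 * ((1 - s) / 3) - 2 * s ^ 2 - 2 * s * ((1 - s) / 3))), ?_⟩
  simp only [Matrix.smul_mul, Matrix.sub_mul, Matrix.mul_add, Matrix.add_mul,
    Matrix.mul_sub, Matrix.mul_smul, Matrix.one_mul, Matrix.mul_one, Matrix.mul_assoc,
    hPP, hPU, hPV, hUP, hVP, hPDP, hPPD, Matrix.trace_smul, Matrix.trace_sub, Matrix.trace_add,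
    Matrix.trace_zero, Matrix.trace_one, htP, htU, htV, htX, htY, hDtr, Fintype.card_fin,
    smul_eq_mul]
  push_cast
  module
end

section
/- Let a, b, c > 0, s = (b + √(b²+24ac))/(4c), and let L1, L2, L3 ∈ ℝ with L1 > 0 and L1+L2+L3 > 0. Let n : ℝ³ → ℝ³ be a smooth map with |n(x)| = 1 for all x, and let m : ℝ³ → ℝ³ be smooth with m(x)·n(x) = 0 for all x, and suppose sup|∇n| ≤ K, sup|m| ≤ K, sup|∇m| ≤ K. Then for every δ > 0 there exists a constant C, depending only on δ, K, a, b, c, L1, L2, L3, such that for every ε ∈ (0,1] and every smooth compactly supported Q : ℝ³ → 𝕊₀, with W = (1/ε)H_{s,n(x)}(Q) + L(Q): (i) (1/ε)∫_{ℝ³} ((n⊗m + m⊗n)·Q) : Q dx ≤ δ∫_{ℝ³} W:W dx + C( ∫_{ℝ³} W:Q dx + ∫_{ℝ³} |Q|² dx ), and (ii) (1/ε)∫_{ℝ³} (Q:(n⊗m + m⊗n))(Q:nn) dx ≤ δ∫_{ℝ³} W:W dx + C( ∫_{ℝ³} W:Q dx + ∫_{ℝ³} |Q|² dx ). -/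
open Matrix MeasureTheory

/-- The linearized operator
`H_{s,n}(Q) = bs(Q − (nn·Q + Q·nn) + (2/3)(Q:nn)I) + 2cs²(Q:nn)(nn − (1/3)I)`. -/
noncomputable def Hop (b c s : ℝ) (n : Fin 3 → ℝ) (Q : Matrix (Fin 3) (Fin 3) ℝ) :
    Matrix (Fin 3) (Fin 3) ℝ :=
  (b * s) • (Q - (vecMulVec n n * Q + Q * vecMulVec n n)
      + (2 / 3 * (n ⬝ᵥ Q *ᵥ n)) • (1 : Matrix (Fin 3) (Fin 3) ℝ))
    + (2 * c * s ^ 2 * (n ⬝ᵥ Q *ᵥ n)) •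
      (vecMulVec n n - (1 / 3 : ℝ) • (1 : Matrix (Fin 3) (Fin 3) ℝ))

/-- Partial derivative `∂_i f` of a scalar function on `ℝ³`. -/
noncomputable def pd (i : Fin 3) (f : (Fin 3 → ℝ) → ℝ) (x : Fin 3 → ℝ) : ℝ :=
  fderiv ℝ f x (Pi.single i 1)

/-- The elastic operator, componentwise:
`(L(Q))_{kl} = −( L1 ΔQ_{kl} + (1/2)(L2+L3)( ∂_m∂_l Q_{km} + ∂_m∂_k Q_{lm}
  − (2/3)δ_{kl} ∂_i∂_j Q_{ij} ) )`. -/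
noncomputable def Lop (L1 L2 L3 : ℝ) (Q : (Fin 3 → ℝ) → Matrix (Fin 3) (Fin 3) ℝ)
    (x : Fin 3 → ℝ) : Matrix (Fin 3) (Fin 3) ℝ :=
  Matrix.of fun k l =>
    -(L1 * (∑ i, pd i (pd i (fun y => Q y k l)) x)
      + 1 / 2 * (L2 + L3) *
        ((∑ m, pd m (pd l (fun y => Q y k m)) x)
          + (∑ m, pd m (pd k (fun y => Q y l m)) x)
          - 2 / 3 * (if k = l then ∑ i, ∑ j, pd i (pd j (fun y => Q y i j)) x else 0)))

/-- Smooth functions with compact support. -/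
def IsTest (f : (Fin 3 → ℝ) → ℝ) : Prop := ContDiff ℝ (⊤ : ℕ∞) f ∧ HasCompactSupport f

namespace IsTest

variable {f g : (Fin 3 → ℝ) → ℝ}

lemma add (hf : IsTest f) (hg : IsTest g) : IsTest fun x => f x + g x :=
  ⟨hf.1.add hg.1, hf.2.add hg.2⟩

lemma zero : IsTest fun _ => 0 := ⟨contDiff_const, HasCompactSupport.zero⟩

lemma smul_left (hf : ContDiff ℝ (⊤ : ℕ∞) f) (hg : IsTest g) : IsTest fun x => f x * g x :=
  ⟨hf.mul hg.1, hg.2.mul_left⟩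

lemma mul (hf : IsTest f) (hg : IsTest g) : IsTest fun x => f x * g x := smul_left hf.1 hg

lemma const_mul (r : ℝ) (hg : IsTest g) : IsTest fun x => r * g x := smul_left contDiff_const hg

lemma neg (hf : IsTest f) : IsTest fun x => -f x := by
  simpa using hf.const_mul (-1)

lemma sub (hf : IsTest f) (hg : IsTest g) : IsTest fun x => f x - g x := by
  simpa [sub_eq_add_neg] using hf.add hg.neg

lemma sq (hf : IsTest f) : IsTest fun x => f x ^ 2 := by
  simpa [_root_.sq] using hf.mul hf

lemma sum {ι : Type*} (s : Finset ι) {F : ι → (Fin 3 → ℝ) → ℝ} (h : ∀ i, IsTest (F i)) :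
    IsTest fun x => ∑ i ∈ s, F i x := by
  classical
  induction s using Finset.induction_on with
  | empty => simpa using zero
  | insert a s ha ih => simpa [Finset.sum_insert ha] using (h a).add ih

lemma integrable (hf : IsTest f) : Integrable f :=
  hf.1.continuous.integrable_of_hasCompactSupport hf.2

end IsTest

lemma contDiff_pd {f : (Fin 3 → ℝ) → ℝ} (hf : ContDiff ℝ (⊤ : ℕ∞) f) (i : Fin 3) :
    ContDiff ℝ (⊤ : ℕ∞) (pd i f) :=
  (hf.fderiv_right (m := (⊤ : ℕ∞)) (by simp)).clm_apply contDiff_const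

lemma IsTest.pd {f : (Fin 3 → ℝ) → ℝ} (hf : IsTest f) (i : Fin 3) : IsTest (pd i f) :=
  ⟨contDiff_pd hf.1 i, hf.2.fderiv_apply ℝ _⟩

lemma pd_comm {f : (Fin 3 → ℝ) → ℝ} (hf : ContDiff ℝ (⊤ : ℕ∞) f) (i j : Fin 3) :
    pd i (pd j f) = pd j (pd i f) := by
  have hd : Differentiable ℝ (fderiv ℝ f) :=
    (hf.fderiv_right (m := (⊤ : ℕ∞)) (by simp)).differentiable (by simp)
  have key (i j : Fin 3) (x) :
      pd i (pd j f) x = fderiv ℝ (fderiv ℝ f) x (Pi.single i 1) (Pi.single j 1) := by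
    unfold pd
    rw [fderiv_clm_apply (hd x) (differentiableAt_const _)]
    simp
  ext x
  rw [key, key]
  exact (hf.contDiffAt.isSymmSndFDerivAt (by simpa using WithTop.coe_le_coe.2 (le_top : (2 : ℕ∞) ≤ ⊤))) _ _

lemma pd_mul {f g : (Fin 3 → ℝ) → ℝ} (hf : ContDiff ℝ (⊤ : ℕ∞) f) (hg : ContDiff ℝ (⊤ : ℕ∞) g)
    (i : Fin 3) (x : Fin 3 → ℝ) :
    pd i (fun y => f y * g y) x = pd i f x * g x + f x * pd i g x := by
  unfold pd
  rw [fderiv_fun_mul (hf.differentiable (by simp) x) (hg.differentiable (by simp) x)]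
  simp
  ring

lemma pd_sum {ι : Type*} (s : Finset ι) {F : ι → (Fin 3 → ℝ) → ℝ}
    (h : ∀ a, ContDiff ℝ (⊤ : ℕ∞) (F a)) (i : Fin 3) (x : Fin 3 → ℝ) :
    pd i (fun y => ∑ a ∈ s, F a y) x = ∑ a ∈ s, pd i (F a) x := by
  unfold pd
  rw [fderiv_fun_sum fun a _ => (h a).differentiable (by simp) x]
  simp

lemma integral_pd_mul {f g : (Fin 3 → ℝ) → ℝ} (hf : IsTest f) (hg : IsTest g) (i : Fin 3) :
    ∫ x, pd i f x * g x = -∫ x, f x * pd i g x := by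
  have h := integral_mul_fderiv_eq_neg_fderiv_mul_of_integrable (μ := volume)
    (v := (Pi.single i 1 : Fin 3 → ℝ))
    ((hf.pd i).mul hg).integrable (hf.mul (hg.pd i)).integrable (hf.mul hg).integrable
    (fun x _ => hf.1.differentiable (by simp) x) (fun x _ => hg.1.differentiable (by simp) x)
  change ∫ x, f x * pd i g x = -∫ x, pd i f x * g x at h
  rw [h, neg_neg]

lemma integral_pd_mul_pd_comm {f g : (Fin 3 → ℝ) → ℝ} (hf : IsTest f) (hg : IsTest g)
    (i j : Fin 3) : ∫ x, pd i f x * pd j g x = ∫ x, pd j f x * pd i g x := by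
  have h1 := integral_pd_mul (hf.pd i) hg j
  have h2 := integral_pd_mul (hf.pd j) hg i
  rw [pd_comm hf.1 j i] at h1
  linarith

/-- The bilinear form of the elastic energy, in the arrays `P k l i = ∂_i Q_{kl}` and
`S k l i = ∂_i R_{kl}`. -/
noncomputable def elasticForm (L1 L : ℝ) (P S : Fin 3 → Fin 3 → Fin 3 → ℝ) : ℝ :=
  ∑ k, ∑ l, (L1 * (∑ i, P k l i * S l k i)
    + 1 / 2 * L * ((∑ m, P k m l * S l k m) + (∑ m, P l m k * S l k m)
      - 2 / 3 * (if k = l then ∑ i, ∑ j, P i j j * S l k i else 0)))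

/-- The squared Euclidean norm of a three-index array. -/
noncomputable def arraySq (P : Fin 3 → Fin 3 → Fin 3 → ℝ) : ℝ := ∑ k, ∑ l, ∑ i, P k l i ^ 2

lemma sq_le_arraySq (P : Fin 3 → Fin 3 → Fin 3 → ℝ) (k l i : Fin 3) :
    P k l i ^ 2 ≤ arraySq P := by
  have h1 : P k l i ^ 2 ≤ ∑ i, P k l i ^ 2 :=
    Finset.single_le_sum (f := fun i => P k l i ^ 2) (fun _ _ => sq_nonneg _) (Finset.mem_univ i)
  have h2 : ∑ i, P k l i ^ 2 ≤ ∑ l, ∑ i, P k l i ^ 2 :=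
    Finset.single_le_sum (f := fun l => ∑ i, P k l i ^ 2)
      (fun _ _ => Finset.sum_nonneg fun _ _ => sq_nonneg _) (Finset.mem_univ l)
  have h3 : ∑ l, ∑ i, P k l i ^ 2 ≤ arraySq P :=
    Finset.single_le_sum (f := fun k => ∑ l, ∑ i, P k l i ^ 2)
      (fun _ _ => Finset.sum_nonneg fun _ _ => Finset.sum_nonneg fun _ _ => sq_nonneg _)
      (Finset.mem_univ k)
  linarith

lemma abs_sum_fin_three_le {f : Fin 3 → ℝ} {A : ℝ} (h : ∀ i, |f i| ≤ A) :
    |∑ i, f i| ≤ 3 * A := by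
  refine (Finset.abs_sum_le_sum_abs _ _).trans ?_
  simpa using Finset.sum_le_card_nsmul Finset.univ (fun i => |f i|) A fun i _ => h i

lemma abs_elasticForm_le (L1 L : ℝ) (P S : Fin 3 → Fin 3 → Fin 3 → ℝ) :
    |elasticForm L1 L P S| ≤ (27 * |L1| + 54 * |L|) * (arraySq P + arraySq S) := by
  set N := arraySq P + arraySq S with hN
  have h (k l i k' l' i') : |P k l i * S k' l' i'| ≤ N := by
    rw [abs_mul]
    nlinarith [sq_le_arraySq P k l i, sq_le_arraySq S k' l' i', sq_abs (P k l i),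
      sq_abs (S k' l' i'), sq_nonneg (|P k l i| - |S k' l' i'|), sq_nonneg (P k l i),
      sq_nonneg (S k' l' i')]
  have hN0 : 0 ≤ N := (abs_nonneg _).trans (h 0 0 0 0 0 0)
  have hterm (k l : Fin 3) : |L1 * (∑ i, P k l i * S l k i)
      + 1 / 2 * L * ((∑ m, P k m l * S l k m) + (∑ m, P l m k * S l k m)
        - 2 / 3 * (if k = l then ∑ i, ∑ j, P i j j * S l k i else 0))|
      ≤ 3 * |L1| * N + 6 * |L| * N := by
    have e1 : |∑ i, P k l i * S l k i| ≤ 3 * N := abs_sum_fin_three_le fun i => h ..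
    have e2 : |∑ m, P k m l * S l k m| ≤ 3 * N := abs_sum_fin_three_le fun i => h ..
    have e3 : |∑ m, P l m k * S l k m| ≤ 3 * N := abs_sum_fin_three_le fun i => h ..
    have e4 : |if k = l then ∑ i, ∑ j, P i j j * S l k i else 0| ≤ 3 * (3 * N) := by
      split_ifs
      · exact abs_sum_fin_three_le fun i => abs_sum_fin_three_le fun j => h ..
      · simpa using hN0
    have e5 : |(∑ m, P k m l * S l k m) + (∑ m, P l m k * S l k m)
        - 2 / 3 * (if k = l then ∑ i, ∑ j, P i j j * S l k i else 0)| ≤ 12 * N := by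
      rw [abs_le] at e2 e3 e4 ⊢
      constructor <;> linarith [e2.1, e2.2, e3.1, e3.2, e4.1, e4.2]
    refine (abs_add_le _ _).trans ?_
    rw [abs_mul, abs_mul, abs_mul]
    have : |(1 / 2 : ℝ)| = 1 / 2 := by norm_num
    rw [this]
    nlinarith [mul_le_mul_of_nonneg_left e1 (abs_nonneg L1),
      mul_le_mul_of_nonneg_left e5 (abs_nonneg L)]
  calc |elasticForm L1 L P S| ≤ 3 * (3 * (3 * |L1| * N + 6 * |L| * N)) :=
        abs_sum_fin_three_le fun k => abs_sum_fin_three_le fun l => hterm k l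
    _ = _ := by ring

lemma elasticForm_self (L1 L : ℝ) {P : Fin 3 → Fin 3 → Fin 3 → ℝ}
    (hsymm : ∀ k l i, P k l i = P l k i) (htr : ∀ i, ∑ k, P k k i = 0) :
    elasticForm L1 L P P = L1 * arraySq P + L * ∑ k, ∑ l, ∑ m, P k m l * P k l m := by
  have h1 (k l i) : P k l i * P l k i = P k l i ^ 2 := by rw [hsymm l k, sq]
  have h2 (k l m) : P k m l * P l k m = P k m l * P k l m := by rw [hsymm l k]
  have h3 : ∑ k, ∑ l, ∑ i, ∑ j, (if k = l then P i j j * P l k i else 0) = 0 := by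
    have : ∀ k, ∑ l, ∑ i, ∑ j, (if k = l then P i j j * P l k i else 0)
        = ∑ i, ∑ j, P i j j * P k k i := fun k => by
      rw [Finset.sum_eq_single k]
      · simp
      · intro l _ hl
        simp [hl.symm]
      · simp
    simp_rw [this]
    rw [Finset.sum_comm]
    refine Finset.sum_eq_zero fun i _ => ?_
    rw [Finset.sum_comm]
    refine Finset.sum_eq_zero fun j _ => ?_
    rw [← Finset.mul_sum, htr, mul_zero]
  have h4 (k l : Fin 3) : (if k = l then ∑ i, ∑ j, P i j j * P l k i else 0)
      = ∑ i, ∑ j, (if k = l then P i j j * P l k i else 0) := by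
    split_ifs <;> simp
  have h5 : ∑ k, ∑ l, ∑ m, P l m k * P l k m = ∑ k, ∑ l, ∑ m, P k m l * P k l m :=
    Finset.sum_comm
  unfold elasticForm arraySq
  simp_rw [h4, h1, h2, mul_sub, mul_add, Finset.sum_add_distrib, Finset.sum_sub_distrib,
    Finset.sum_add_distrib, ← Finset.mul_sum]
  rw [h3, h5]
  ring

lemma integral_pd_pd_mul {f g : (Fin 3 → ℝ) → ℝ} (hf : IsTest f) (hg : IsTest g) (i j : Fin 3) :
    ∫ x, -(pd i (pd j f) x * g x) = ∫ x, pd j f x * pd i g x := by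
  rw [integral_neg, integral_pd_mul (hf.pd j) hg i, neg_neg]

section

variable {Q R W : (Fin 3 → ℝ) → Matrix (Fin 3) (Fin 3) ℝ}

lemma frob_eq_sum (A B : Matrix (Fin 3) (Fin 3) ℝ) : frob A B = ∑ k, ∑ l, A k l * B l k := by
  simp [frob, Matrix.trace, Matrix.mul_apply]

lemma isTest_frob (hW : ∀ k l, IsTest fun y => W y k l) (hR : ∀ k l, IsTest fun y => R y k l) :
    IsTest fun x => frob (W x) (R x) := by
  simp_rw [frob_eq_sum]
  exact IsTest.sum _ fun k => IsTest.sum _ fun l => (hW k l).mul (hR l k)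

lemma isTest_Lop (L1 L2 L3 : ℝ) (hQ : ∀ k l, IsTest fun y => Q y k l) (k l : Fin 3) :
    IsTest fun x => Lop L1 L2 L3 Q x k l := by
  have h2 (i j k l : Fin 3) : IsTest (pd i (pd j fun y => Q y k l)) := ((hQ k l).pd j).pd i
  refine IsTest.neg (IsTest.add (IsTest.const_mul _ (IsTest.sum _ fun i => h2 ..))
    (IsTest.const_mul _ (IsTest.sub (IsTest.add (IsTest.sum _ fun i => h2 ..)
      (IsTest.sum _ fun i => h2 ..)) (IsTest.const_mul _ ?_))))
  split_ifs
  · exact IsTest.sum _ fun i => IsTest.sum _ fun j => h2 ..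
  · exact IsTest.zero

/-- The gradient array `∂_i Q_{kl}`. -/
noncomputable def grad (Q : (Fin 3 → ℝ) → Matrix (Fin 3) (Fin 3) ℝ) (x : Fin 3 → ℝ)
    (k l i : Fin 3) : ℝ := pd i (fun y => Q y k l) x

lemma isTest_arraySq_grad (hQ : ∀ k l, IsTest fun y => Q y k l) :
    IsTest fun x => arraySq (grad Q x) :=
  IsTest.sum _ fun k => IsTest.sum _ fun l => IsTest.sum _ fun i => ((hQ k l).pd i).sq

lemma isTest_elasticForm (L1 L : ℝ) (hQ : ∀ k l, IsTest fun y => Q y k l)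
    (hR : ∀ k l, IsTest fun y => R y k l) :
    IsTest fun x => elasticForm L1 L (grad Q x) (grad R x) := by
  have h (k l i k' l' i') : IsTest fun x => grad Q x k l i * grad R x k' l' i' :=
    ((hQ k l).pd i).mul ((hR k' l').pd i')
  refine IsTest.sum _ fun k => IsTest.sum _ fun l => (IsTest.add (IsTest.const_mul _
    (IsTest.sum _ fun i => h ..)) (IsTest.const_mul _ (IsTest.sub (IsTest.add
      (IsTest.sum _ fun i => h ..) (IsTest.sum _ fun i => h ..)) (IsTest.const_mul _ ?_))))
  split_ifs
  · exact IsTest.sum _ fun i => IsTest.sum _ fun j => h ..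
  · exact IsTest.zero

/-- Two test functions with the same integral. -/
def SameIntegral (F G : (Fin 3 → ℝ) → ℝ) : Prop :=
  IsTest F ∧ IsTest G ∧ ∫ x, F x = ∫ x, G x

namespace SameIntegral

variable {F G F' G' : (Fin 3 → ℝ) → ℝ}

lemma add (h : SameIntegral F G) (h' : SameIntegral F' G') :
    SameIntegral (fun x => F x + F' x) (fun x => G x + G' x) := by
  refine ⟨h.1.add h'.1, h.2.1.add h'.2.1, ?_⟩
  rw [integral_add h.1.integrable h'.1.integrable,
    integral_add h.2.1.integrable h'.2.1.integrable, h.2.2, h'.2.2]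

lemma const_mul (r : ℝ) (h : SameIntegral F G) :
    SameIntegral (fun x => r * F x) (fun x => r * G x) := by
  refine ⟨h.1.const_mul r, h.2.1.const_mul r, ?_⟩
  rw [integral_const_mul, integral_const_mul, h.2.2]

lemma zero : SameIntegral (fun _ => 0) (fun _ => 0) := ⟨IsTest.zero, IsTest.zero, rfl⟩

lemma sub (h : SameIntegral F G) (h' : SameIntegral F' G') :
    SameIntegral (fun x => F x - F' x) (fun x => G x - G' x) := by
  simpa [sub_eq_add_neg] using h.add (h'.const_mul (-1))

lemma sum {ι : Type*} (s : Finset ι) {F G : ι → (Fin 3 → ℝ) → ℝ}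
    (h : ∀ i, SameIntegral (F i) (G i)) :
    SameIntegral (fun x => ∑ i ∈ s, F i x) (fun x => ∑ i ∈ s, G i x) := by
  classical
  induction s using Finset.induction_on with
  | empty => simpa using zero
  | insert a s ha ih => simpa [Finset.sum_insert ha] using (h a).add ih

end SameIntegral

lemma integral_frob_Lop (L1 L2 L3 : ℝ) (hQ : ∀ k l, IsTest fun y => Q y k l)
    (hR : ∀ k l, IsTest fun y => R y k l) :
    ∫ x, frob (Lop L1 L2 L3 Q x) (R x)
      = ∫ x, elasticForm L1 (L2 + L3) (grad Q x) (grad R x) := by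
  have h (i j k l k' l') :
      SameIntegral (fun x => -(pd i (pd j fun y => Q y k l) x * R x k' l'))
        (fun x => grad Q x k l j * grad R x k' l' i) :=
    ⟨((((hQ k l).pd j).pd i).mul (hR k' l')).neg, ((hQ k l).pd j).mul ((hR k' l').pd i),
      integral_pd_pd_mul (hQ k l) (hR k' l') i j⟩
  have key : SameIntegral
      (fun x => ∑ k, ∑ l, (L1 * (∑ i, -(pd i (pd i fun y => Q y k l) x * R x l k))
        + 1 / 2 * (L2 + L3) * ((∑ m, -(pd m (pd l fun y => Q y k m) x * R x l k))
          + (∑ m, -(pd m (pd k fun y => Q y l m) x * R x l k))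
          - 2 / 3 * (if k = l then ∑ i, ∑ j, -(pd i (pd j fun y => Q y i j) x * R x l k)
            else 0))))
      (fun x => elasticForm L1 (L2 + L3) (grad Q x) (grad R x)) := by
    refine .sum _ fun k => .sum _ fun l => (SameIntegral.add (.const_mul _
      (.sum _ fun i => h ..)) (.const_mul _ (.sub (.add (.sum _ fun i => h ..)
        (.sum _ fun i => h ..)) (.const_mul _ ?_))))
    split_ifs
    · exact .sum _ fun i => .sum _ fun j => h ..
    · exact .zero
  rw [← key.2.2]
  congr 1
  ext x
  rw [frob_eq_sum]
  refine Finset.sum_congr rfl fun k _ => Finset.sum_congr rfl fun l _ => ?_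
  simp only [Lop, Matrix.of_apply, Finset.sum_neg_distrib, ← Finset.sum_mul]
  split_ifs <;> ring

lemma arraySq_nonneg (P : Fin 3 → Fin 3 → Fin 3 → ℝ) : 0 ≤ arraySq P :=
  (sq_nonneg _).trans (sq_le_arraySq P 0 0 0)

lemma integral_frob_Lop_self_ge (L1 L2 L3 : ℝ) (hQ : ∀ k l, IsTest fun y => Q y k l)
    (hsymm : ∀ x, (Q x).IsSymm) (htr : ∀ x, (Q x).trace = 0) :
    min L1 (L1 + L2 + L3) * ∫ x, arraySq (grad Q x) ≤ ∫ x, frob (Lop L1 L2 L3 Q x) (Q x) := by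
  have hs (x k l i) : grad Q x k l i = grad Q x l k i := by
    simp only [grad, fun y => (hsymm y).apply l k]
  have ht (x i) : ∑ k, grad Q x k k i = 0 := by
    simp only [grad]
    rw [← pd_sum Finset.univ (fun k => (hQ k k).1)]
    have : (fun y => ∑ k, Q y k k) = fun _ => 0 := by
      ext y
      exact htr y
    simp [this, pd]
  have hG := isTest_arraySq_grad hQ
  have hD : SameIntegral (fun x => ∑ k, ∑ l, ∑ m, grad Q x k m l * grad Q x k l m)
      (fun x => ∑ k, ∑ l, ∑ m, grad Q x k m m * grad Q x k l l) :=
    .sum _ fun k => .sum _ fun l => .sum _ fun m =>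
      ⟨((hQ k m).pd l).mul ((hQ k l).pd m), ((hQ k m).pd m).mul ((hQ k l).pd l),
        integral_pd_mul_pd_comm (hQ k m) (hQ k l) l m⟩
  have hD0 : 0 ≤ ∫ x, ∑ k, ∑ l, ∑ m, grad Q x k m l * grad Q x k l m := by
    rw [hD.2.2]
    refine integral_nonneg fun x => Finset.sum_nonneg fun k _ => ?_
    simp_rw [← Finset.sum_mul, ← Finset.mul_sum]
    exact mul_self_nonneg _
  have hDG : ∫ x, ∑ k, ∑ l, ∑ m, grad Q x k m l * grad Q x k l m
      ≤ ∫ x, arraySq (grad Q x) := by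
    refine integral_mono hD.1.integrable hG.integrable fun x => ?_
    have hswap (k) : ∑ l, ∑ m, grad Q x k m l ^ 2 = ∑ l, ∑ m, grad Q x k l m ^ 2 :=
      Finset.sum_comm
    refine Finset.sum_le_sum fun k _ => ?_
    have : ∑ l, ∑ m, grad Q x k m l * grad Q x k l m
        ≤ ∑ l, ∑ m, (1 / 2 * grad Q x k m l ^ 2 + 1 / 2 * grad Q x k l m ^ 2) :=
      Finset.sum_le_sum fun l _ => Finset.sum_le_sum fun m _ => by
        nlinarith [sq_nonneg (grad Q x k m l - grad Q x k l m)]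
    refine this.trans_eq ?_
    simp_rw [Finset.sum_add_distrib, ← Finset.mul_sum, hswap]
    ring
  have hG0 : 0 ≤ ∫ x, arraySq (grad Q x) := integral_nonneg fun x => arraySq_nonneg _
  rw [integral_frob_Lop L1 L2 L3 hQ hQ]
  simp_rw [fun x => elasticForm_self L1 (L2 + L3) (hs x) (ht x)]
  rw [integral_add (hG.const_mul L1).integrable (hD.1.const_mul _).integrable,
    integral_const_mul, integral_const_mul]
  rcases le_total 0 (L2 + L3) with h | h
  · nlinarith [min_le_left L1 (L1 + L2 + L3), hG0, mul_nonneg h hD0]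
  · nlinarith [min_le_right L1 (L1 + L2 + L3), hG0, mul_le_mul_of_nonpos_left hDG h]

end

section

variable {b c s : ℝ} {n m : Fin 3 → ℝ} {Q : Matrix (Fin 3) (Fin 3) ℝ}

lemma frob_vecMulVec (A : Matrix (Fin 3) (Fin 3) ℝ) (u v : Fin 3 → ℝ) :
    frob A (vecMulVec u v) = v ⬝ᵥ A *ᵥ u := by
  simp [frob, Matrix.mul_vecMulVec, Matrix.trace_vecMulVec, dotProduct_comm]

lemma Hop_mulVec (u : Fin 3 → ℝ) :
    Hop b c s n Q *ᵥ u = (b * s) • (Q *ᵥ u - ((n ⬝ᵥ Q *ᵥ u) • n + (n ⬝ᵥ u) • Q *ᵥ n)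
        + (2 / 3 * (n ⬝ᵥ Q *ᵥ n)) • u)
      + (2 * c * s ^ 2 * (n ⬝ᵥ Q *ᵥ n)) • ((n ⬝ᵥ u) • n - (1 / 3 : ℝ) • u) := by
  simp only [Hop, Matrix.add_mulVec, Matrix.sub_mulVec, Matrix.smul_mulVec, Matrix.one_mulVec,
    ← Matrix.mulVec_mulVec, Matrix.vecMulVec_mulVec, Matrix.mulVec_smul, op_smul_eq_smul]

lemma dotProduct_Hop_mulVec_self (hn : n ⬝ᵥ n = 1) :
    n ⬝ᵥ Hop b c s n Q *ᵥ n = (4 * c * s ^ 2 - b * s) / 3 * (n ⬝ᵥ Q *ᵥ n) := by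
  rw [Hop_mulVec]
  simp only [dotProduct_add, dotProduct_sub, dotProduct_smul, smul_eq_mul, hn]
  ring

lemma dotProduct_Hop_mulVec_of_orthogonal (hm : m ⬝ᵥ n = 0) :
    m ⬝ᵥ Hop b c s n Q *ᵥ (Q *ᵥ n) = b * s * (m ⬝ᵥ Q *ᵥ (Q *ᵥ n))
      - (b * s + 2 * c * s ^ 2) / 3 * (n ⬝ᵥ Q *ᵥ n) * (m ⬝ᵥ Q *ᵥ n) := by
  rw [Hop_mulVec]
  simp only [dotProduct_add, dotProduct_sub, dotProduct_smul, smul_eq_mul, hm]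
  ring

/-- The matrix with `frob (Hop b c s n Q) (crossTerm α κ n m Q)` bilinear in the kernel and the
range components of `Q`. -/
def crossTerm (α κ : ℝ) (n m : Fin 3 → ℝ) (Q : Matrix (Fin 3) (Fin 3) ℝ) :
    Matrix (Fin 3) (Fin 3) ℝ :=
  α • vecMulVec (Q *ᵥ n) m + (κ * (m ⬝ᵥ Q *ᵥ n)) • vecMulVec n n

lemma frob_crossTerm (A : Matrix (Fin 3) (Fin 3) ℝ) (α κ : ℝ) :
    frob A (crossTerm α κ n m Q)
      = α * (m ⬝ᵥ A *ᵥ (Q *ᵥ n)) + κ * (m ⬝ᵥ Q *ᵥ n) * (n ⬝ᵥ A *ᵥ n) := by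
  rw [← frob_vecMulVec A, ← frob_vecMulVec A]
  simp only [frob, crossTerm, Matrix.mul_add, Matrix.mul_smul, Matrix.trace_add,
    Matrix.trace_smul, smul_eq_mul]

lemma dotProduct_mulVec_comm (hQ : Q.IsSymm) (u v : Fin 3 → ℝ) :
    u ⬝ᵥ Q *ᵥ v = v ⬝ᵥ Q *ᵥ u := by
  rw [Matrix.dotProduct_mulVec, ← Matrix.mulVec_transpose, hQ, dotProduct_comm]

lemma frob_symm_mul_self (hQ : Q.IsSymm) :
    frob ((vecMulVec n m + vecMulVec m n) * Q) Q = 2 * (m ⬝ᵥ Q *ᵥ (Q *ᵥ n)) := by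
  have h1 : frob ((vecMulVec n m + vecMulVec m n) * Q) Q
      = frob (Q * Q) (vecMulVec n m) + frob (Q * Q) (vecMulVec m n) := by
    simp only [frob]
    rw [Matrix.mul_assoc, Matrix.trace_mul_comm, Matrix.mul_add, Matrix.trace_add]
  rw [h1, frob_vecMulVec, frob_vecMulVec, ← Matrix.mulVec_mulVec, ← Matrix.mulVec_mulVec,
    dotProduct_mulVec_comm hQ n, dotProduct_mulVec_comm hQ m, dotProduct_comm (Q *ᵥ m)]
  ring

lemma frob_symm (hQ : Q.IsSymm) :
    frob Q (vecMulVec n m + vecMulVec m n) = 2 * (m ⬝ᵥ Q *ᵥ n) := by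
  have h1 : frob Q (vecMulVec n m + vecMulVec m n)
      = frob Q (vecMulVec n m) + frob Q (vecMulVec m n) := by
    simp only [frob, Matrix.mul_add, Matrix.trace_add]
  rw [h1, frob_vecMulVec, frob_vecMulVec, dotProduct_mulVec_comm hQ n]
  ring

lemma frob_Hop_crossTerm_fst (hbs : b * s ≠ 0) (hlam : 4 * c * s ^ 2 - b * s ≠ 0)
    (hn : n ⬝ᵥ n = 1) (hm : m ⬝ᵥ n = 0) (hQ : Q.IsSymm) :
    frob (Hop b c s n Q) (crossTerm (2 / (b * s))
      (2 * (b * s + 2 * c * s ^ 2) / (b * s * (4 * c * s ^ 2 - b * s))) n m Q)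
      = frob ((vecMulVec n m + vecMulVec m n) * Q) Q := by
  rw [frob_crossTerm, dotProduct_Hop_mulVec_self hn, dotProduct_Hop_mulVec_of_orthogonal hm,
    frob_symm_mul_self hQ]
  have key (β γ t X y q : ℝ) (hβ : β ≠ 0) (hγ : γ ≠ 0) :
      2 / β * (β * X - (β + t) / 3 * q * y) + 2 * (β + t) / (β * γ) * y * (γ / 3 * q)
        = 2 * X := by
    field_simp
    ring
  exact key _ _ _ _ _ _ hbs hlam

lemma frob_Hop_crossTerm_snd (hlam : 4 * c * s ^ 2 - b * s ≠ 0)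
    (hn : n ⬝ᵥ n = 1) (hQ : Q.IsSymm) :
    frob (Hop b c s n Q) (crossTerm 0 (6 / (4 * c * s ^ 2 - b * s)) n m Q)
      = frob Q (vecMulVec n m + vecMulVec m n) * (n ⬝ᵥ Q *ᵥ n) := by
  rw [frob_crossTerm, dotProduct_Hop_mulVec_self hn, frob_symm hQ]
  generalize 4 * c * s ^ 2 - b * s = γ at hlam
  field_simp
  ring

lemma frob_self_nonneg {A : Matrix (Fin 3) (Fin 3) ℝ} (hA : A.IsSymm) : 0 ≤ frob A A := by
  rw [frob_eq_sum]
  exact Finset.sum_nonneg fun k _ => Finset.sum_nonneg fun l _ => by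
    rw [hA.apply]
    exact mul_self_nonneg _

lemma frob_self_ge (hn : n ⬝ᵥ n = 1) (hQ : Q.IsSymm) (htr : Q.trace = 0) :
    0 ≤ frob Q Q - 2 * (Q *ᵥ n ⬝ᵥ Q *ᵥ n) + (n ⬝ᵥ Q *ᵥ n) ^ 2 / 2 := by
  set u := Q *ᵥ n with hu
  set q := n ⬝ᵥ u with hq
  have hvec (v : Fin 3 → ℝ) : v ᵥ* Q = Q *ᵥ v := by rw [← Matrix.mulVec_transpose, hQ]
  have hX : (Q - (vecMulVec n u + vecMulVec u n) + (q / 2) • (vecMulVec n n + 1)).IsSymm := by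
    simp only [Matrix.IsSymm, Matrix.transpose_add, Matrix.transpose_sub, Matrix.transpose_smul,
      Matrix.transpose_vecMulVec, Matrix.transpose_one, hQ.eq]
    rw [add_comm (vecMulVec u n)]
  have h := frob_self_nonneg hX
  have hun : u ⬝ᵥ n = q := dotProduct_comm _ _
  have hQu : n ⬝ᵥ Q *ᵥ u = u ⬝ᵥ u := by rw [dotProduct_mulVec_comm hQ]
  convert h using 1
  simp only [frob, Matrix.add_mul, Matrix.mul_add, Matrix.sub_mul, Matrix.mul_sub, Matrix.smul_mul,
    Matrix.mul_smul, Matrix.mul_one, Matrix.one_mul, Matrix.trace_add, Matrix.trace_sub,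
    Matrix.trace_smul, Matrix.mul_vecMulVec, Matrix.vecMulVec_mul, Matrix.trace_vecMulVec,
    Matrix.vecMulVec_mulVec, op_smul_eq_smul, Matrix.trace_one, hn, htr, hvec, hun, ← hu, ← hq,
    Matrix.add_mulVec, Matrix.sub_mulVec, Matrix.smul_mulVec, Matrix.one_mulVec, add_dotProduct,
    sub_dotProduct, dotProduct_comm (Q *ᵥ u) n,
    smul_dotProduct, hQu, smul_eq_mul, Fintype.card_fin, smul_add]
  push_cast
  ring

lemma frob_Hop_self_nonneg (hb : 0 ≤ b) (hs : 0 ≤ s) (hbc : b ≤ 4 * c * s) (hn : n ⬝ᵥ n = 1)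
    (hQ : Q.IsSymm) (htr : Q.trace = 0) : 0 ≤ frob (Hop b c s n Q) Q := by
  have h1 : frob (Hop b c s n Q) Q = b * s * (frob Q Q - 2 * (Q *ᵥ n ⬝ᵥ Q *ᵥ n))
      + 2 * c * s ^ 2 * (n ⬝ᵥ Q *ᵥ n) ^ 2 := by
    have hvec (v : Fin 3 → ℝ) : v ᵥ* Q = Q *ᵥ v := by rw [← Matrix.mulVec_transpose, hQ]
    have hQu : n ⬝ᵥ Q *ᵥ (Q *ᵥ n) = Q *ᵥ n ⬝ᵥ Q *ᵥ n := by rw [dotProduct_mulVec_comm hQ]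
    simp only [frob, Hop, Matrix.add_mul, Matrix.sub_mul, Matrix.smul_mul,
      Matrix.one_mul, Matrix.trace_add, Matrix.trace_sub,
      Matrix.trace_smul, Matrix.mul_vecMulVec, Matrix.vecMulVec_mul, Matrix.trace_vecMulVec,
      htr, hvec, smul_eq_mul, hQu]
    ring
  rw [h1]
  nlinarith [mul_nonneg (mul_nonneg hb hs) (frob_self_ge hn hQ htr),
    mul_nonneg (mul_nonneg hs (sub_nonneg.2 hbc)) (sq_nonneg (n ⬝ᵥ Q *ᵥ n))]

end

/-- Smooth functions bounded by `M` together with their first partial derivatives. -/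
def C1BoundedBy (M : ℝ) (f : (Fin 3 → ℝ) → ℝ) : Prop :=
  ContDiff ℝ (⊤ : ℕ∞) f ∧ (∀ x, |f x| ≤ M) ∧ ∀ i x, |pd i f x| ≤ M

namespace C1BoundedBy

variable {A B : ℝ} {f g : (Fin 3 → ℝ) → ℝ}

lemma nonneg (hf : C1BoundedBy A f) : 0 ≤ A := (abs_nonneg _).trans (hf.2.1 0)

lemma mul (hf : C1BoundedBy A f) (hg : C1BoundedBy B g) :
    C1BoundedBy (2 * (A * B)) fun x => f x * g x := by
  have hA := hf.nonneg
  have hB := hg.nonneg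
  refine ⟨hf.1.mul hg.1, fun x => ?_, fun i x => ?_⟩
  · rw [abs_mul]
    nlinarith [mul_le_mul (hf.2.1 x) (hg.2.1 x) (abs_nonneg _) hA, mul_nonneg hA hB]
  · rw [pd_mul hf.1 hg.1]
    refine (abs_add_le _ _).trans ?_
    rw [abs_mul, abs_mul]
    nlinarith [mul_le_mul (hf.2.2 i x) (hg.2.1 x) (abs_nonneg _) hA,
      mul_le_mul (hf.2.1 x) (hg.2.2 i x) (abs_nonneg _) hA]

lemma const_mul {r s : ℝ} (hr : |r| ≤ s) (hf : C1BoundedBy A f) :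
    C1BoundedBy (s * A) fun x => r * f x := by
  refine ⟨contDiff_const.mul hf.1, fun x => ?_, fun i x => ?_⟩
  · rw [abs_mul]
    exact mul_le_mul hr (hf.2.1 x) (abs_nonneg _) ((abs_nonneg _).trans hr)
  · have h : pd i (fun x => r * f x) x = r * pd i f x := by
      rw [pd_mul contDiff_const hf.1]
      simp [pd]
    rw [h, abs_mul]
    exact mul_le_mul hr (hf.2.2 i x) (abs_nonneg _) ((abs_nonneg _).trans hr)

lemma add (hf : C1BoundedBy A f) (hg : C1BoundedBy B g) :
    C1BoundedBy (A + B) fun x => f x + g x := by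
  refine ⟨hf.1.add hg.1, fun x => ?_, fun i x => ?_⟩
  · exact (abs_add_le _ _).trans (add_le_add (hf.2.1 x) (hg.2.1 x))
  · have h : pd i (fun x => f x + g x) x = pd i f x + pd i g x := by
      unfold pd
      rw [fderiv_fun_add (hf.1.differentiable (by simp) x) (hg.1.differentiable (by simp) x)]
      simp
    rw [h]
    exact (abs_add_le _ _).trans (add_le_add (hf.2.2 i x) (hg.2.2 i x))

end C1BoundedBy

lemma sq_sum_sum_le (x : Fin 3 → Fin 3 → ℝ) : (∑ p, ∑ r, x p r) ^ 2 ≤ 9 * ∑ p, ∑ r, x p r ^ 2 := by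
  have h1 : (∑ p, ∑ r, x p r) ^ 2 ≤ 3 * ∑ p, (∑ r, x p r) ^ 2 := by
    simpa using sq_sum_le_card_mul_sum_sq (s := Finset.univ) (f := fun p => ∑ r, x p r)
  have h2 : ∑ p, (∑ r, x p r) ^ 2 ≤ ∑ p, 3 * ∑ r, x p r ^ 2 :=
    Finset.sum_le_sum fun p _ => by
      simpa using sq_sum_le_card_mul_sum_sq (s := Finset.univ) (f := x p)
  rw [← Finset.mul_sum] at h2
  linarith

lemma sum_fin_three_le {f : Fin 3 → ℝ} {A : ℝ} (h : ∀ i, f i ≤ A) : ∑ i, f i ≤ 3 * A := by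
  simpa using Finset.sum_le_card_nsmul Finset.univ f A fun i _ => h i

lemma frob_self_eq {A : Matrix (Fin 3) (Fin 3) ℝ} (hA : A.IsSymm) :
    frob A A = ∑ k, ∑ l, A k l ^ 2 := by
  rw [frob_eq_sum]
  exact Finset.sum_congr rfl fun k _ => Finset.sum_congr rfl fun l _ => by rw [hA.apply, sq]

section

variable {M : ℝ} {A : Fin 3 → Fin 3 → Fin 3 → Fin 3 → (Fin 3 → ℝ) → ℝ}
  {Q R : (Fin 3 → ℝ) → Matrix (Fin 3) (Fin 3) ℝ}

lemma sum_sq_le_of_C1BoundedBy (hA : ∀ k l p r, C1BoundedBy M (A k l p r))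
    (hR : ∀ k l, (fun y => R y k l) = fun y => ∑ p, ∑ r, A k l p r y * Q y p r)
    (x : Fin 3 → ℝ) : ∑ k, ∑ l, R x k l ^ 2 ≤ 81 * M ^ 2 * ∑ p, ∑ r, Q x p r ^ 2 := by
  have h (k l) : R x k l ^ 2 ≤ 9 * (M ^ 2 * ∑ p, ∑ r, Q x p r ^ 2) := by
    rw [show R x k l = _ from congrFun (hR k l) x]
    refine (sq_sum_sum_le _).trans ?_
    simp_rw [Finset.mul_sum]
    refine Finset.sum_le_sum fun p _ => Finset.sum_le_sum fun r _ => ?_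
    have := sq_le_sq' (abs_le.1 ((hA k l p r).2.1 x)).1 (abs_le.1 ((hA k l p r).2.1 x)).2
    rw [mul_pow]
    nlinarith [mul_le_mul_of_nonneg_right this (sq_nonneg (Q x p r))]
  exact (sum_fin_three_le fun k => sum_fin_three_le fun l => h k l).trans_eq (by ring)

lemma arraySq_grad_le_of_C1BoundedBy (hQ : ∀ k l, IsTest fun y => Q y k l)
    (hA : ∀ k l p r, C1BoundedBy M (A k l p r))
    (hR : ∀ k l, (fun y => R y k l) = fun y => ∑ p, ∑ r, A k l p r y * Q y p r)
    (x : Fin 3 → ℝ) : arraySq (grad R x)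
      ≤ 486 * M ^ 2 * ((∑ p, ∑ r, Q x p r ^ 2) + arraySq (grad Q x)) := by
  have h (k l i) : grad R x k l i ^ 2
      ≤ 18 * (M ^ 2 * ((∑ p, ∑ r, Q x p r ^ 2) + arraySq (grad Q x))) := by
    have hAQ (p r) : ContDiff ℝ (⊤ : ℕ∞) fun y => A k l p r y * Q y p r :=
      (hA k l p r).1.mul (hQ p r).1
    have e : grad R x k l i
        = ∑ p, ∑ r, (pd i (A k l p r) x * Q x p r + A k l p r x * grad Q x p r i) := by
      unfold grad
      rw [hR k l, pd_sum _ fun p => ContDiff.sum fun r _ => hAQ p r]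
      refine Finset.sum_congr rfl fun p _ => ?_
      rw [pd_sum _ fun r => hAQ p r]
      exact Finset.sum_congr rfl fun r _ => pd_mul (hA k l p r).1 (hQ p r).1 i x
    have hle : ∑ p, ∑ r, grad Q x p r i ^ 2 ≤ arraySq (grad Q x) :=
      Finset.sum_le_sum fun p _ => Finset.sum_le_sum fun r _ =>
        Finset.single_le_sum (f := fun i => grad Q x p r i ^ 2) (fun _ _ => sq_nonneg _)
          (Finset.mem_univ i)
    have hx (p r) : (pd i (A k l p r) x * Q x p r + A k l p r x * grad Q x p r i) ^ 2
        ≤ 2 * M ^ 2 * (Q x p r ^ 2 + grad Q x p r i ^ 2) := by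
      have h1 := sq_le_sq' (abs_le.1 ((hA k l p r).2.1 x)).1 (abs_le.1 ((hA k l p r).2.1 x)).2
      have h2 := sq_le_sq' (abs_le.1 ((hA k l p r).2.2 i x)).1 (abs_le.1 ((hA k l p r).2.2 i x)).2
      nlinarith [mul_le_mul_of_nonneg_right h2 (sq_nonneg (Q x p r)),
        mul_le_mul_of_nonneg_right h1 (sq_nonneg (grad Q x p r i)),
        sq_nonneg (pd i (A k l p r) x * Q x p r - A k l p r x * grad Q x p r i)]
    rw [e]
    have hsum := Finset.sum_le_sum fun p (_ : p ∈ Finset.univ) =>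
      Finset.sum_le_sum fun r (_ : r ∈ Finset.univ) => hx p r
    simp_rw [← Finset.mul_sum, Finset.sum_add_distrib] at hsum
    nlinarith [sq_sum_sum_le fun p r =>
      pd i (A k l p r) x * Q x p r + A k l p r x * grad Q x p r i,
      mul_le_mul_of_nonneg_left hle (sq_nonneg M)]
  exact (sum_fin_three_le fun k => sum_fin_three_le fun l => sum_fin_three_le fun i =>
    h k l i).trans_eq (by ring)

end

lemma frob_le_of_isSymm {A B : Matrix (Fin 3) (Fin 3) ℝ} (hA : A.IsSymm) {δ : ℝ} (hδ : 0 < δ) :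
    frob A B ≤ δ * frob A A + 1 / (4 * δ) * ∑ k, ∑ l, B k l ^ 2 := by
  rw [frob_self_eq hA, frob_eq_sum, Finset.sum_comm]
  simp_rw [Finset.mul_sum, ← Finset.sum_add_distrib]
  refine Finset.sum_le_sum fun k _ => Finset.sum_le_sum fun l _ => ?_
  rw [hA.apply]
  have : δ * A k l ^ 2 + 1 / (4 * δ) * B k l ^ 2 - A k l * B k l
      = (2 * δ * A k l - B k l) ^ 2 / (4 * δ) := by
    field_simp
    ring
  have h0 : 0 ≤ (2 * δ * A k l - B k l) ^ 2 / (4 * δ) := by positivity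
  linarith

lemma Hop_apply (b c s : ℝ) (n : Fin 3 → ℝ) (Q : Matrix (Fin 3) (Fin 3) ℝ) (k l : Fin 3) :
    Hop b c s n Q k l = b * s * (Q k l - ((∑ p, n k * n p * Q p l) + ∑ p, n p * n l * Q k p))
      + (b * s * (2 / 3) * (if k = l then 1 else 0)
        + 2 * c * s ^ 2 * (n k * n l - 1 / 3 * (if k = l then 1 else 0)))
        * ∑ p, ∑ r, n p * n r * Q p r := by
  have h1 : (vecMulVec n n * Q) k l = ∑ p, n k * n p * Q p l := by
    simp [Matrix.mul_apply, vecMulVec_apply]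
  have h2 : (Q * vecMulVec n n) k l = ∑ p, n p * n l * Q k p := by
    simp [Matrix.mul_apply, vecMulVec_apply, mul_comm]
  have h3 : n ⬝ᵥ Q *ᵥ n = ∑ p, ∑ r, n p * n r * Q p r := by
    simp only [dotProduct, mulVec, Finset.mul_sum]
    exact Finset.sum_congr rfl fun p _ => Finset.sum_congr rfl fun r _ => by ring
  simp only [Hop, Matrix.add_apply, Matrix.sub_apply, Matrix.smul_apply, h1, h2, h3,
    Matrix.one_apply, vecMulVec_apply, smul_eq_mul]
  ring

lemma crossTerm_apply (α κ : ℝ) (n m : Fin 3 → ℝ) (Q : Matrix (Fin 3) (Fin 3) ℝ) (k l : Fin 3) :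
    crossTerm α κ n m Q k l = ∑ p, ∑ r,
      ((if k = p then α else 0) * (m l * n r) + κ * ((m p * n r) * (n k * n l))) * Q p r := by
  simp only [crossTerm, Matrix.add_apply, Matrix.smul_apply, vecMulVec_apply, smul_eq_mul,
    dotProduct, mulVec, add_mul, Finset.sum_add_distrib]
  congr 1
  · symm
    rw [Finset.sum_eq_single k]
    · simp only [if_true, Finset.sum_mul, Finset.mul_sum]
      exact Finset.sum_congr rfl fun r _ => by ring
    · intro p _ hp
      simp [hp.symm]
    · simp
  · simp only [Finset.sum_mul, Finset.mul_sum]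
    exact Finset.sum_congr rfl fun p _ => Finset.sum_congr rfl fun r _ => by ring

lemma isTest_Hop (b c s : ℝ) {n : (Fin 3 → ℝ) → Fin 3 → ℝ}
    {Q : (Fin 3 → ℝ) → Matrix (Fin 3) (Fin 3) ℝ} (hn : ∀ k, ContDiff ℝ (⊤ : ℕ∞) fun y => n y k)
    (hQ : ∀ k l, IsTest fun y => Q y k l) (k l : Fin 3) :
    IsTest fun x => Hop b c s (n x) (Q x) k l := by
  simp_rw [Hop_apply]
  have h (k l p r) : IsTest fun x => n x k * n x l * Q x p r :=
    IsTest.smul_left ((hn k).mul (hn l)) (hQ p r)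
  refine IsTest.add (IsTest.const_mul _ (IsTest.sub (hQ k l) (IsTest.add
    (IsTest.sum _ fun p => h ..) (IsTest.sum _ fun p => h ..))))
    (IsTest.smul_left ?_ (IsTest.sum _ fun p => IsTest.sum _ fun r => h ..))
  exact contDiff_const.add (contDiff_const.mul (((hn k).mul (hn l)).sub contDiff_const))

lemma Hop_isSymm (b c s : ℝ) (n : Fin 3 → ℝ) {Q : Matrix (Fin 3) (Fin 3) ℝ} (hQ : Q.IsSymm) :
    (Hop b c s n Q).IsSymm := by
  simp only [Hop, Matrix.IsSymm, Matrix.transpose_add, Matrix.transpose_sub, Matrix.transpose_smul,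
    Matrix.transpose_mul, Matrix.transpose_vecMulVec, Matrix.transpose_one, hQ.eq]
  rw [add_comm (Q * _)]

lemma Lop_isSymm (L1 L2 L3 : ℝ) {Q : (Fin 3 → ℝ) → Matrix (Fin 3) (Fin 3) ℝ}
    (hQ : ∀ x, (Q x).IsSymm) (x : Fin 3 → ℝ) : (Lop L1 L2 L3 Q x).IsSymm := by
  refine Matrix.IsSymm.ext fun k l => ?_
  have h : (fun y => Q y k l) = fun y => Q y l k := funext fun y => (hQ y).apply l k
  simp only [Lop, Matrix.of_apply, h, eq_comm (a := l)]
  ring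

lemma singular_integral_le {L1 L2 L3 : ℝ} (h1 : 0 < L1) (h123 : 0 < L1 + L2 + L3)
    {δ B C : ℝ} (hδ : 0 < δ) (hB : 0 ≤ B)
    (hC : B / (4 * δ) + (27 * |L1| + 54 * |L2 + L3|) * B
      + (27 * |L1| + 54 * |L2 + L3|) * (1 + B) / min L1 (L1 + L2 + L3) ≤ C)
    {ε : ℝ} (hε : 0 < ε) {Q R H W : (Fin 3 → ℝ) → Matrix (Fin 3) (Fin 3) ℝ}
    (hQ : ∀ k l, IsTest fun y => Q y k l) (hR : ∀ k l, IsTest fun y => R y k l)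
    (hH : ∀ k l, IsTest fun y => H y k l)
    (hQs : ∀ x, (Q x).IsSymm) (hQt : ∀ x, (Q x).trace = 0) (hHs : ∀ x, (H x).IsSymm)
    (hW : ∀ x, W x = (1 / ε) • H x + Lop L1 L2 L3 Q x)
    (hHQ : ∀ x, 0 ≤ frob (H x) (Q x))
    (hRQ : ∀ x, ∑ k, ∑ l, R x k l ^ 2 ≤ B * frob (Q x) (Q x))
    (hgrad : ∀ x, arraySq (grad R x) ≤ B * (frob (Q x) (Q x) + arraySq (grad Q x))) :
    (1 / ε) * (∫ x, frob (H x) (R x)) ≤ δ * (∫ x, frob (W x) (W x))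
      + C * ((∫ x, frob (W x) (Q x)) + ∫ x, frob (Q x) (Q x)) := by
  set ℓ := 27 * |L1| + 54 * |L2 + L3| with hℓ
  have hℓ0 : 0 ≤ ℓ := by positivity
  set c0 := min L1 (L1 + L2 + L3) with hc0
  have hc0pos : 0 < c0 := lt_min h1 h123
  have hL := isTest_Lop L1 L2 L3 hQ
  have hWt (k l) : IsTest fun y => W y k l := by
    simp_rw [hW]
    exact ((hH k l).const_mul (1 / ε)).add (hL k l)
  have hWs (x) : (W x).IsSymm := by
    rw [hW]
    exact ((hHs x).smul _).add (Lop_isSymm L1 L2 L3 hQs x)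
  have hsplit (S : (Fin 3 → ℝ) → Matrix (Fin 3) (Fin 3) ℝ) (hS : ∀ k l, IsTest fun y => S y k l) :
      ∫ x, frob (W x) (S x)
        = (1 / ε) * (∫ x, frob (H x) (S x)) + ∫ x, frob (Lop L1 L2 L3 Q x) (S x) := by
    rw [← integral_const_mul, ← integral_add ((isTest_frob hH hS).const_mul _).integrable
      (isTest_frob hL hS).integrable]
    congr 1
    ext x
    simp [hW, frob, Matrix.add_mul]
  have hWR : ∫ x, frob (W x) (R x)
      ≤ δ * (∫ x, frob (W x) (W x)) + B / (4 * δ) * ∫ x, frob (Q x) (Q x) := by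
    rw [← integral_const_mul, ← integral_const_mul, ← integral_add
      ((isTest_frob hWt hWt).const_mul _).integrable ((isTest_frob hQ hQ).const_mul _).integrable]
    refine integral_mono (isTest_frob hWt hR).integrable (((isTest_frob hWt hWt).const_mul _).add
      ((isTest_frob hQ hQ).const_mul _)).integrable fun x => ?_
    refine (frob_le_of_isSymm (hWs x) hδ).trans ?_
    have h := mul_le_mul_of_nonneg_left (hRQ x) (by positivity : 0 ≤ 1 / (4 * δ))
    have e : 1 / (4 * δ) * (B * frob (Q x) (Q x)) = B / (4 * δ) * frob (Q x) (Q x) := by ring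
    linarith
  have hLR : -∫ x, frob (Lop L1 L2 L3 Q x) (R x)
      ≤ ℓ * (1 + B) * (∫ x, arraySq (grad Q x)) + ℓ * B * ∫ x, frob (Q x) (Q x) := by
    rw [integral_frob_Lop L1 L2 L3 hQ hR, ← integral_neg, ← integral_const_mul,
      ← integral_const_mul, ← integral_add ((isTest_arraySq_grad hQ).const_mul _).integrable
        ((isTest_frob hQ hQ).const_mul _).integrable]
    refine integral_mono (isTest_elasticForm _ _ hQ hR).neg.integrable
      (((isTest_arraySq_grad hQ).const_mul _).add
        ((isTest_frob hQ hQ).const_mul _)).integrable fun x => ?_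
    have h := abs_elasticForm_le L1 (L2 + L3) (grad Q x) (grad R x)
    have h' := mul_le_mul_of_nonneg_left (hgrad x) hℓ0
    have h'' := neg_le_abs (elasticForm L1 (L2 + L3) (grad Q x) (grad R x))
    change -elasticForm L1 (L2 + L3) (grad Q x) (grad R x)
      ≤ ℓ * (1 + B) * arraySq (grad Q x) + ℓ * B * frob (Q x) (Q x)
    nlinarith
  have hLQ := integral_frob_Lop_self_ge L1 L2 L3 hQ hQs hQt
  have hHQ0 : 0 ≤ (1 / ε) * ∫ x, frob (H x) (Q x) :=
    mul_nonneg (by positivity) (integral_nonneg hHQ)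
  have hG0 : 0 ≤ ∫ x, arraySq (grad Q x) := integral_nonneg fun x => arraySq_nonneg _
  have hQ0 : 0 ≤ ∫ x, frob (Q x) (Q x) := integral_nonneg fun x => frob_self_nonneg (hQs x)
  have hWQ : c0 * ∫ x, arraySq (grad Q x) ≤ ∫ x, frob (W x) (Q x) := by
    rw [hsplit Q hQ]
    linarith
  have hWQ0 : 0 ≤ ∫ x, frob (W x) (Q x) := (mul_nonneg hc0pos.le hG0).trans hWQ
  have hG : ℓ * (1 + B) * (∫ x, arraySq (grad Q x))
      ≤ ℓ * (1 + B) / c0 * ∫ x, frob (W x) (Q x) := by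
    rw [div_mul_eq_mul_div, le_div_iff₀ hc0pos]
    nlinarith [mul_le_mul_of_nonneg_left hWQ (by positivity : 0 ≤ ℓ * (1 + B))]
  have hR' := hsplit R hR
  have hc1 : 0 ≤ B / (4 * δ) := by positivity
  have hc2 : 0 ≤ ℓ * (1 + B) / c0 := by positivity
  have hc3 : 0 ≤ ℓ * B := by positivity
  have hCW := mul_le_mul_of_nonneg_right hC (add_nonneg hWQ0 hQ0)
  nlinarith [mul_nonneg hc1 hWQ0, mul_nonneg hc3 hWQ0, mul_nonneg hc2 hQ0]

/-- A bound for the coefficients of `crossTerm` when `n`, `m` and their derivatives are bounded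
by `M`. -/
noncomputable def crossBound (α κ M : ℝ) : ℝ :=
  |α| * (2 * (M * M)) + |κ| * (2 * (2 * (M * M) * (2 * (M * M))))

lemma singular_crossTerm_integral_le {L1 L2 L3 : ℝ} (h1 : 0 < L1) (h123 : 0 < L1 + L2 + L3)
    {b c s : ℝ} (hb : 0 ≤ b) (hs : 0 ≤ s) (hbc : b ≤ 4 * c * s) {α κ M δ B C : ℝ} (hδ : 0 < δ)
    (hBdef : B = 486 * crossBound α κ M ^ 2)
    (hC : B / (4 * δ) + (27 * |L1| + 54 * |L2 + L3|) * B
      + (27 * |L1| + 54 * |L2 + L3|) * (1 + B) / min L1 (L1 + L2 + L3) ≤ C)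
    {ε : ℝ} (hε : 0 < ε) {n m : (Fin 3 → ℝ) → Fin 3 → ℝ} (hn1 : ∀ x, n x ⬝ᵥ n x = 1)
    (hn : ∀ k, C1BoundedBy M fun y => n y k) (hm : ∀ k, C1BoundedBy M fun y => m y k)
    {Q W : (Fin 3 → ℝ) → Matrix (Fin 3) (Fin 3) ℝ}
    (hQ : ∀ k l, IsTest fun y => Q y k l) (hQs : ∀ x, (Q x).IsSymm) (hQt : ∀ x, (Q x).trace = 0)
    (hW : ∀ x, W x = (1 / ε) • Hop b c s (n x) (Q x) + Lop L1 L2 L3 Q x) :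
    (1 / ε) * (∫ x, frob (Hop b c s (n x) (Q x)) (crossTerm α κ (n x) (m x) (Q x)))
      ≤ δ * (∫ x, frob (W x) (W x))
        + C * ((∫ x, frob (W x) (Q x)) + ∫ x, frob (Q x) (Q x)) := by
  have hA (k l p r : Fin 3) : C1BoundedBy (crossBound α κ M) fun y =>
      (if k = p then α else 0) * (m y l * n y r) + κ * ((m y p * n y r) * (n y k * n y l)) := by
    refine (((hm l).mul (hn r)).const_mul ?_).add
      ((((hm p).mul (hn r)).mul ((hn k).mul (hn l))).const_mul le_rfl)
    split_ifs
    · exact le_rfl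
    · simp
  have hR (k l : Fin 3) := funext fun y => crossTerm_apply α κ (n y) (m y) (Q y) k l
  have hRtest (k l : Fin 3) : IsTest fun y => crossTerm α κ (n y) (m y) (Q y) k l := by
    rw [hR]
    exact IsTest.sum _ fun p => IsTest.sum _ fun r => (hQ p r).smul_left (hA k l p r).1
  refine singular_integral_le h1 h123 hδ (by rw [hBdef]; positivity) hC hε hQ hRtest
    (isTest_Hop b c s (fun k => (hn k).1) hQ) hQs hQt (fun x => Hop_isSymm b c s (n x) (hQs x)) hW
    (fun x => frob_Hop_self_nonneg hb hs hbc (hn1 x) (hQs x) (hQt x)) (fun x => ?_) fun x => ?_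
  · have h := sum_sq_le_of_C1BoundedBy
      (R := fun y => crossTerm α κ (n y) (m y) (Q y)) (Q := Q) hA hR x
    rw [← frob_self_eq (hQs x)] at h
    rw [hBdef]
    nlinarith [mul_nonneg (sq_nonneg (crossBound α κ M)) (frob_self_nonneg (hQs x))]
  · have h := arraySq_grad_le_of_C1BoundedBy
      (R := fun y => crossTerm α κ (n y) (m y) (Q y)) hQ hA hR x
    rwa [← frob_self_eq (hQs x), ← hBdef] at h

lemma abs_le_of_sqrt_sum_sq_le {f : Fin 3 → ℝ} {K : ℝ} (h : √(∑ i, f i ^ 2) ≤ K) (i : Fin 3) :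
    |f i| ≤ K :=
  (Real.abs_le_sqrt (Finset.single_le_sum (f := fun i => f i ^ 2) (fun _ _ => sq_nonneg _)
    (Finset.mem_univ i))).trans h

lemma C1BoundedBy.of_sqrt_le {f : (Fin 3 → ℝ) → Fin 3 → ℝ} {A K M : ℝ} (hA : A ≤ M) (hK : K ≤ M)
    (hf : ∀ k, ContDiff ℝ (⊤ : ℕ∞) fun y => f y k)
    (h0 : ∀ x, √(∑ i, f x i ^ 2) ≤ A)
    (h1 : ∀ x, √(∑ i, ∑ j, pd j (fun y => f y i) x ^ 2) ≤ K) (k : Fin 3) :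
    C1BoundedBy M fun y => f y k := by
  refine ⟨hf k, fun x => (abs_le_of_sqrt_sum_sq_le (h0 x) k).trans hA, fun j x => ?_⟩
  refine (Real.abs_le_sqrt ?_).trans ((h1 x).trans hK)
  have h2 : pd j (fun y => f y k) x ^ 2 ≤ ∑ j, pd j (fun y => f y k) x ^ 2 :=
    Finset.single_le_sum (f := fun j => pd j (fun y => f y k) x ^ 2) (fun _ _ => sq_nonneg _)
      (Finset.mem_univ j)
  exact h2.trans (Finset.single_le_sum (f := fun k => ∑ j, pd j (fun y => f y k) x ^ 2)
    (fun _ _ => Finset.sum_nonneg fun _ _ => sq_nonneg _) (Finset.mem_univ k))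

/-- The key lemma: the singular term `(1/ε)⟨∂ₜ(nn)·Q, Q⟩` (with `∂ₜ(nn) = n⊗m + m⊗n`)
is controlled, for any `δ > 0`, by `δ⟨W, W⟩ + C(⟨W, Q⟩ + ⟨Q, Q⟩)` where
`W = (1/ε)H_{s,n}(Q) + L(Q)`, with `C` depending only on `δ, K, a, b, c, L1, L2, L3`;
and similarly for `(1/ε)⟨Q:∂ₜ(nn), Q:nn⟩`. -/
theorem stmt_19 (a b c : ℝ) (ha : 0 < a) (hb : 0 < b) (hc : 0 < c)
    (s : ℝ) (hs : s = (b + Real.sqrt (b ^ 2 + 24 * a * c)) / (4 * c))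
    (L1 L2 L3 : ℝ) (h1 : 0 < L1) (h123 : 0 < L1 + L2 + L3)
    (K : ℝ) (δ : ℝ) (hδ : 0 < δ) :
    ∃ C : ℝ,
      ∀ (n m : (Fin 3 → ℝ) → Fin 3 → ℝ),
        (∀ k, ContDiff ℝ (⊤ : ℕ∞) (fun y => n y k)) →
        (∀ x, (n x) ⬝ᵥ (n x) = 1) →
        (∀ k, ContDiff ℝ (⊤ : ℕ∞) (fun y => m y k)) →
        (∀ x, (m x) ⬝ᵥ (n x) = 0) →
        (∀ x, Real.sqrt (∑ i, ∑ j, (pd j (fun y => n y i) x) ^ 2) ≤ K) →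
        (∀ x, Real.sqrt (∑ i, (m x i) ^ 2) ≤ K) →
        (∀ x, Real.sqrt (∑ i, ∑ j, (pd j (fun y => m y i) x) ^ 2) ≤ K) →
        ∀ ε : ℝ, 0 < ε → ε ≤ 1 →
        ∀ Q : (Fin 3 → ℝ) → Matrix (Fin 3) (Fin 3) ℝ,
          (∀ k l, ContDiff ℝ (⊤ : ℕ∞) (fun y => Q y k l)) →
          (∀ k l, HasCompactSupport (fun y => Q y k l)) →
          (∀ x, (Q x).IsSymm) → (∀ x, (Q x).trace = 0) →
          ∀ W : (Fin 3 → ℝ) → Matrix (Fin 3) (Fin 3) ℝ,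
            (∀ x, W x = (1 / ε) • Hop b c s (n x) (Q x) + Lop L1 L2 L3 Q x) →
            ((1 / ε) * (∫ x : Fin 3 → ℝ,
                frob ((vecMulVec (n x) (m x) + vecMulVec (m x) (n x)) * Q x) (Q x)) ≤
              δ * (∫ x : Fin 3 → ℝ, frob (W x) (W x))
                + C * ((∫ x : Fin 3 → ℝ, frob (W x) (Q x))
                  + ∫ x : Fin 3 → ℝ, frob (Q x) (Q x))) ∧
            ((1 / ε) * (∫ x : Fin 3 → ℝ,
                frob (Q x) (vecMulVec (n x) (m x) + vecMulVec (m x) (n x))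
                  * ((n x) ⬝ᵥ (Q x) *ᵥ (n x))) ≤
              δ * (∫ x : Fin 3 → ℝ, frob (W x) (W x))
                + C * ((∫ x : Fin 3 → ℝ, frob (W x) (Q x))
                  + ∫ x : Fin 3 → ℝ, frob (Q x) (Q x))) := by
  have hsqrt : 0 < √(b ^ 2 + 24 * a * c) := Real.sqrt_pos.2 (by positivity)
  have hspos : 0 < s := by
    rw [hs]
    positivity
  have h4 : 4 * c * s = b + √(b ^ 2 + 24 * a * c) := by
    rw [hs]
    field_simp
  have hbc : b < 4 * c * s := by linarith
  have hbs : b * s ≠ 0 := by positivity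
  have hlam : 4 * c * s ^ 2 - b * s ≠ 0 := by
    have : 4 * c * s ^ 2 - b * s = s * (4 * c * s - b) := by ring
    rw [this]
    exact mul_ne_zero hspos.ne' (by linarith)
  set M := max 1 K with hM
  set κ := 2 * (b * s + 2 * c * s ^ 2) / (b * s * (4 * c * s ^ 2 - b * s)) with hκ
  let B (α κ : ℝ) : ℝ := 486 * crossBound α κ M ^ 2
  let C (α κ : ℝ) : ℝ := B α κ / (4 * δ) + (27 * |L1| + 54 * |L2 + L3|) * B α κ
    + (27 * |L1| + 54 * |L2 + L3|) * (1 + B α κ) / min L1 (L1 + L2 + L3)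
  refine ⟨max (C (2 / (b * s)) κ) (C 0 (6 / (4 * c * s ^ 2 - b * s))),
    fun n m hn hn1 hm hmn hgn hm0 hgm ε hε _ Q hQ hQc hQs hQt W hW => ?_⟩
  have hnM := C1BoundedBy.of_sqrt_le (M := M) (le_max_left 1 K) (le_max_right 1 K) hn
    (fun x => by
      have : ∑ i, n x i ^ 2 = 1 := by
        simpa [dotProduct, sq] using hn1 x
      simp [this]) hgn
  have hmM := C1BoundedBy.of_sqrt_le (M := M) (le_max_right 1 K) (le_max_right 1 K) hm hm0 hgm
  have hQtest (k l : Fin 3) : IsTest fun y => Q y k l := ⟨hQ k l, hQc k l⟩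
  constructor
  · simp_rw [← fun x => frob_Hop_crossTerm_fst hbs hlam (hn1 x) (hmn x) (hQs x)]
    exact singular_crossTerm_integral_le h1 h123 hb.le hspos.le hbc.le hδ rfl
      (le_max_left _ _) hε hn1 hnM hmM hQtest hQs hQt hW
  · simp_rw [← fun x => frob_Hop_crossTerm_snd (m := m x) hlam (hn1 x) (hQs x)]
    exact singular_crossTerm_integral_le h1 h123 hb.le hspos.le hbc.le hδ rfl
      (le_max_right _ _) hε hn1 hnM hmM hQtest hQs hQt hW
end
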